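/- The following are equivalent: (i) φ ↦ C_φ : CB^σ_e(M) → B(H) is surjective; (ii) φ ↦ D_φ : CB^σ_e(M) → T(H) is surjective; (iii) {A x0 : A ∈ M} = H; (iv) M is finite dimensional. -/

import Mathlib

set_option synthInstance.maxHeartbeats 1000000
set_option maxHeartbeats 1000000

noncomputable section

open scoped InnerProductSpace ComplexOrder
open ContinuousLinearMap

local notation "⟪" x ", " y "⟫" => @inner ℂ _ _ x y

namespace ChoiInf

variable {H : Type*} [NormedAddCommGroup H] [InnerProductSpace ℂ H] [CompleteSpace H]

/-- The rank one operator `x ⊠ y : z ↦ (z|y)·x = ⟪y, z⟫ • x`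
(inner products written with Mathlib's convention: conjugate linear in the
first variable, so that the paper's `(z|y)` is `⟪y, z⟫`). -/
def rankOne (x y : H) : H →L[ℂ] H := (innerSL ℂ y).smulRight x

/-- The trace of an operator, computed relative to a Hilbert basis:
`Tr X = Σᵢ (X eᵢ | eᵢ) = Σᵢ ⟪eᵢ, X eᵢ⟫`.  (For trace class operators this does
not depend on the choice of basis.) -/
def tr {ι : Type*} (b : HilbertBasis ι ℂ H) (T : H →L[ℂ] H) : ℂ :=
  ∑' i, ⟪b i, T (b i)⟫

/-- The bilinear pairing `⟨A, B⟩ = Tr (A B)` between `B(H)` and `T(H)`. -/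
def pairing {ι : Type*} (b : HilbertBasis ι ℂ H) (A T : H →L[ℂ] H) : ℂ :=
  tr b (A ∘L T)

/-- Trace class operators, characterized by nuclear representations
`T = Σₙ xₙ ⊠ yₙ` with `Σₙ ‖xₙ‖‖yₙ‖ < ∞`. -/
def IsTraceClass (T : H →L[ℂ] H) : Prop :=
  ∃ x y : ℕ → H, Summable (fun n => ‖x n‖ * ‖y n‖) ∧
    ∀ z, T z = ∑' n, ⟪y n, z⟫ • x n

/-- The trace norm, as the infimum of `Σₙ ‖xₙ‖‖yₙ‖` over all nuclear
representations `T = Σₙ xₙ ⊠ yₙ`. -/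
def traceNorm (T : H →L[ℂ] H) : ℝ :=
  sInf {c : ℝ | ∃ x y : ℕ → H, HasSum (fun n => ‖x n‖ * ‖y n‖) c ∧
    ∀ z, T z = ∑' n, ⟪y n, z⟫ • x n}

/-- `(Φ, Φst)` is a dual pair:  `Φst` preserves the trace class and
`⟨Φ A, T⟩ = ⟨A, Φst T⟩` for all trace class `T`.  A linear map `Φ` on `B(H)` is
normal (σ-weakly continuous) precisely when it admits such a predual map `Φst`. -/
def IsNormalPair {ι : Type*} (b : HilbertBasis ι ℂ H)
    (Φ Φst : (H →L[ℂ] H) →ₗ[ℂ] (H →L[ℂ] H)) : Prop :=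
  (∀ T, IsTraceClass T → IsTraceClass (Φst T)) ∧
    ∀ A T, IsTraceClass T → pairing b (Φ A) T = pairing b A (Φst T)

/-- Positivity of a `k × k` matrix of operators, i.e. positivity of the
corresponding operator on `H ⊕ ⋯ ⊕ H`. -/
def MatPos {k : ℕ} (A : Fin k → Fin k → (H →L[ℂ] H)) : Prop :=
  ∀ v : Fin k → H, 0 ≤ ∑ i, ∑ j, ⟪v i, A i j (v j)⟫

/-- The operator on `H ⊕ ⋯ ⊕ H` given by a `k × k` matrix of operators has norm `≤ c`. -/
def matNormLe {k : ℕ} (A : Fin k → Fin k → (H →L[ℂ] H)) (c : ℝ) : Prop :=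
  ∀ v w : Fin k → H,
    ‖∑ i, ∑ j, ⟪w i, A i j (v j)⟫‖ ≤
      c * Real.sqrt (∑ i, ‖v i‖ ^ 2) * Real.sqrt (∑ i, ‖w i‖ ^ 2)

/-- A von Neumann algebra is a factor when its center consists of the scalars. -/
def IsFactor (M : VonNeumannAlgebra H) : Prop :=
  ∀ T ∈ M, T ∈ M.commutant → ∃ c : ℂ, T = c • (1 : H →L[ℂ] H)

/-- `x0` is a cyclic vector for `M`. -/
def Cyclic (M : VonNeumannAlgebra H) (x0 : H) : Prop :=
  Dense {y : H | ∃ A ∈ M, A x0 = y}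

/-- `x0` is a separating vector for `M`. -/
def Separating (M : VonNeumannAlgebra H) (x0 : H) : Prop :=
  ∀ A ∈ M, A x0 = 0 → A = 0

/-- `Φ` restricts on `alg(M', M)` to the map `φ̃ : A'B ↦ A'·φ(B)`.
(Maps `φ : M → M` are encoded as linear maps on `B(H)` sending `M` into `M`;
only the restriction to `M` is relevant.) -/
def ExtendsTilde (M : VonNeumannAlgebra H)
    (φ Φ : (H →L[ℂ] H) →ₗ[ℂ] (H →L[ℂ] H)) : Prop :=
  ∀ A' ∈ M.commutant, ∀ B ∈ M, Φ (A' * B) = A' * φ B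

/-- The space `CB^σ_ε(M)` of maps `φ : M → M` such that `φ̃` extends to a normal
map on `B(H)`. -/
def CBSigmaE {ι : Type*} (b : HilbertBasis ι ℂ H) (M : VonNeumannAlgebra H) :
    Set ((H →L[ℂ] H) →ₗ[ℂ] (H →L[ℂ] H)) :=
  {φ | (∀ B ∈ M, φ B ∈ M) ∧
    ∃ Φ Φst, ExtendsTilde M φ Φ ∧ IsNormalPair b Φ Φst}

/-- `φ` is completely positive as a map on `M`. -/
def IsCPOn (M : VonNeumannAlgebra H) (φ : (H →L[ℂ] H) →ₗ[ℂ] (H →L[ℂ] H)) : Prop :=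
  ∀ (k : ℕ) (A : Fin k → Fin k → (H →L[ℂ] H)), (∀ i j, A i j ∈ M) →
    MatPos A → MatPos fun i j => φ (A i j)

/-- `φ` is completely positive (on all of `B(H)`). -/
def IsCPFull (φ : (H →L[ℂ] H) →ₗ[ℂ] (H →L[ℂ] H)) : Prop :=
  ∀ (k : ℕ) (A : Fin k → Fin k → (H →L[ℂ] H)), MatPos A → MatPos fun i j => φ (A i j)

/-- `c` is a completely bounded bound for `φ` as a map on `M`. -/
def CBBoundOn (M : VonNeumannAlgebra H) (φ : (H →L[ℂ] H) →ₗ[ℂ] (H →L[ℂ] H))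
    (c : ℝ) : Prop :=
  ∀ (k : ℕ) (A : Fin k → Fin k → (H →L[ℂ] H)), (∀ i j, A i j ∈ M) →
    matNormLe A 1 → matNormLe (fun i j => φ (A i j)) c

/-- The completely bounded norm of `φ` as a map on `M`. -/
def cbNormOn (M : VonNeumannAlgebra H) (φ : (H →L[ℂ] H) →ₗ[ℂ] (H →L[ℂ] H)) : ℝ :=
  sInf {c : ℝ | 0 ≤ c ∧ CBBoundOn M φ c}

/-- `φ` is completely bounded as a map on `M`. -/
def IsCBOn (M : VonNeumannAlgebra H) (φ : (H →L[ℂ] H) →ₗ[ℂ] (H →L[ℂ] H)) : Prop :=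
  ∃ c, 0 ≤ c ∧ CBBoundOn M φ c

/-- `φ` is normal as a map on `M`: every normal functional composed with `φ`
is again normal (i.e. implemented by a trace class operator). -/
def NormalOn {ι : Type*} (b : HilbertBasis ι ℂ H) (M : VonNeumannAlgebra H)
    (φ : (H →L[ℂ] H) →ₗ[ℂ] (H →L[ℂ] H)) : Prop :=
  ∀ T, IsTraceClass T → ∃ T', IsTraceClass T' ∧
    ∀ A ∈ M, pairing b (φ A) T = pairing b A T'

/-- The map `Ad_V : X ↦ V* X V`. -/
def AdL (V : H →L[ℂ] H) : (H →L[ℂ] H) →ₗ[ℂ] (H →L[ℂ] H) where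
  toFun X := star V * X * V
  map_add' X Y := by simp [add_mul, mul_add]
  map_smul' c X := by simp [smul_mul_assoc, mul_smul_comm]

/-- `p` is a minimal (nonzero) projection in `M`. -/
def IsMinimalProjection (M : VonNeumannAlgebra H) (p : H →L[ℂ] H) : Prop :=
  p ∈ M ∧ IsIdempotentElem p ∧ IsSelfAdjoint p ∧ p ≠ 0 ∧
    ∀ q, q ∈ M → IsIdempotentElem q → IsSelfAdjoint q → q ≠ 0 →
      q * p = q → p * q = q → q = p

/-- A factor is of type I precisely when it contains a minimal projection. -/
def IsTypeI (M : VonNeumannAlgebra H) : Prop :=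
  ∃ p, IsMinimalProjection M p




variable {K : Type*} [NormedAddCommGroup K] [InnerProductSpace ℂ K] [CompleteSpace K]

/-- `T` is a Hilbert–Schmidt operator (relative to a Hilbert basis `e`;
this does not depend on the choice of `e`). -/
def IsHS {ι : Type*} (e : HilbertBasis ι ℂ K) (T : K →L[ℂ] K) : Prop :=
  Summable fun i => ‖T (e i)‖ ^ 2

/-- A model of the Hilbert space `HS(K)` of Hilbert–Schmidt operators on `K`,
with `B(K)` acting by left multiplications `Lmul` and right multiplications
`Rmul`.  `toOp` regards a vector of `H` as an operator on `K`; its range is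
exactly the set of Hilbert–Schmidt operators, and the inner product of `H` is
`(x|y) = Tr (x y*)`, i.e. `⟪x, y⟫ = Σᵢ ⟪x eᵢ, y eᵢ⟫`. -/
structure HSModel {ι : Type*} (e : HilbertBasis ι ℂ K) (H : Type*)
    [NormedAddCommGroup H] [InnerProductSpace ℂ H] [CompleteSpace H] where
  toOp : H →ₗ[ℂ] (K →L[ℂ] K)
  inj : Function.Injective toOp
  mem_range : ∀ T : K →L[ℂ] K, IsHS e T ↔ ∃ x : H, toOp x = T
  inner_eq : ∀ x y : H, ⟪x, y⟫ = ∑' i, ⟪toOp x (e i), toOp y (e i)⟫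
  Lmul : (K →L[ℂ] K) → (H →L[ℂ] H)
  Lmul_eq : ∀ a x, toOp (Lmul a x) = a ∘L toOp x
  Rmul : (K →L[ℂ] K) → (H →L[ℂ] H)
  Rmul_eq : ∀ a x, toOp (Rmul a x) = toOp x ∘L a

/-- The operator `T` has rank at most `k`. -/
def rankLE (T : K →L[ℂ] K) (k : ℕ) : Prop :=
  Module.rank ℂ (LinearMap.range (T : K →ₗ[ℂ] K)) ≤ (k : Cardinal)

variable {H : Type*} [NormedAddCommGroup H] [InnerProductSpace ℂ H] [CompleteSpace H]
  {ι : Type*} {e : HilbertBasis ι ℂ K}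

/-- `Φ` restricts to the map `φ̃ : R_y L_x ↦ R_y L_{φ(x)}` on `alg(M', M)` for
`M = L_{B(K)}`. -/
def HSExt (m : HSModel e H) (φ : (K →L[ℂ] K) →ₗ[ℂ] (K →L[ℂ] K))
    (Φ : (H →L[ℂ] H) →ₗ[ℂ] (H →L[ℂ] H)) : Prop :=
  ∀ a x : K →L[ℂ] K, Φ (m.Rmul a ∘L m.Lmul x) = m.Rmul a ∘L m.Lmul (φ x)

/-- `φ` is `k`-positive. -/
def kPos (k : ℕ) (φ : (K →L[ℂ] K) →ₗ[ℂ] (K →L[ℂ] K)) : Prop :=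
  ∀ A : Fin k → Fin k → (K →L[ℂ] K), MatPos A → MatPos fun i j => φ (A i j)

/-- `φ` is completely bounded (as a map on all of `B(K)`). -/
def IsCBFullK (φ : (K →L[ℂ] K) →ₗ[ℂ] (K →L[ℂ] K)) : Prop :=
  ∃ c, 0 ≤ c ∧ ∀ (k : ℕ) (A : Fin k → Fin k → (K →L[ℂ] K)),
    matNormLe A 1 → matNormLe (fun i j => φ (A i j)) c

/-- `φ` belongs to `CB^σ(B(K))`: it is normal and completely bounded. -/
def NormalCB (e : HilbertBasis ι ℂ K) (φ : (K →L[ℂ] K) →ₗ[ℂ] (K →L[ℂ] K)) : Prop :=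
  (∃ φst, IsNormalPair e φ φst) ∧ IsCBFullK φ

/-- The cone `𝒮_k` of `T(H)`: the trace-norm closed convex cone generated by
the `ω_{x,x} = x ⊠ x` with `rank x ≤ k` (rank as an operator on `K`). -/
def SchmidtCone (m : HSModel e H) (k : ℕ) : Set (H →L[ℂ] H) :=
  {T | ∀ ε : ℝ, 0 < ε → ∃ (n : ℕ) (x : Fin n → H),
    (∀ i, rankLE (m.toOp (x i)) k) ∧
      traceNorm (T - ∑ i, rankOne (x i) (x i)) < ε}

/-- `ψ` belongs to the convex cone `𝔼_k` generated by the maps `Ad_V` with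
`rank V ≤ k`. -/
def InEk (k : ℕ) (ψ : (K →L[ℂ] K) →ₗ[ℂ] (K →L[ℂ] K)) : Prop :=
  ∃ (n : ℕ) (V : Fin n → (K →L[ℂ] K)), (∀ i, rankLE (V i) k) ∧
    ∀ x, ψ x = ∑ i, star (V i) * x * V i

/-- `φ` (with Choi trace-class operator `Dphi = D_φ`) is `k`-superpositive:
it lies in the `‖·‖_D`-closure of the cone `𝔼_k`, where `‖ψ‖_D = ‖D_ψ‖_{T(H)}`. -/
def kSuper {ιH : Type*} (bH : HilbertBasis ιH ℂ H) (m : HSModel e H) (x0 : H)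
    (k : ℕ) (Dphi : H →L[ℂ] H) : Prop :=
  ∀ ε : ℝ, 0 < ε → ∃ ψ Ψ Ψst, InEk k ψ ∧ HSExt m ψ Ψ ∧ IsNormalPair bH Ψ Ψst ∧
    traceNorm (Dphi - Ψst (rankOne x0 x0)) < ε


section Helpers

universe u

variable {H : Type*} [NormedAddCommGroup H] [InnerProductSpace ℂ H] [CompleteSpace H]

theorem rankOne_apply (x y z : H) : rankOne x y z = ⟪y, z⟫ • x := rfl

theorem mul_rankOne (A : H →L[ℂ] H) (x y : H) : A * rankOne x y = rankOne (A x) y := by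
  ext z; simp [rankOne_apply]

theorem norm_rankOne (x y : H) : ‖rankOne x y‖ = ‖x‖ * ‖y‖ := by
  simp [rankOne, mul_comm]

/-! ### Nuclear representations and the trace pairing -/

/-- The nuclear representation `T = Σⱼ xⱼ ⊠ yⱼ`, over an arbitrary index type. -/
def IsNuclearRep {J : Type*} (T : H →L[ℂ] H) (x y : J → H) : Prop :=
  Summable (fun j => ‖x j‖ * ‖y j‖) ∧ ∀ z, T z = ∑' j, ⟪y j, z⟫ • x j

theorem summable_inner_apply {J : Type*} {x y : J → H}
    (h : Summable fun j => ‖x j‖ * ‖y j‖) (A : H →L[ℂ] H) :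
    Summable fun j => ⟪y j, A (x j)⟫ := by
  refine Summable.of_norm_bounded (h.mul_left ‖A‖) fun j => ?_
  calc ‖⟪y j, A (x j)⟫‖ ≤ ‖y j‖ * ‖A (x j)‖ := norm_inner_le_norm _ _
    _ ≤ ‖y j‖ * (‖A‖ * ‖x j‖) := by gcongr; exact A.le_opNorm _
    _ = ‖A‖ * (‖x j‖ * ‖y j‖) := by ring

theorem IsNuclearRep.hasSum {J : Type*} {T : H →L[ℂ] H} {x y : J → H}
    (h : IsNuclearRep T x y) (z : H) : HasSum (fun j => ⟪y j, z⟫ • x j) (T z) := by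
  rw [h.2 z]
  refine (Summable.of_norm_bounded (h.1.mul_left ‖z‖) fun j => ?_).hasSum
  rw [norm_smul]
  calc ‖⟪y j, z⟫‖ * ‖x j‖ ≤ ‖y j‖ * ‖z‖ * ‖x j‖ := by gcongr; exact norm_inner_le_norm _ _
    _ = ‖z‖ * (‖x j‖ * ‖y j‖) := by ring

theorem sum_norm_inner_mul_inner_le {ι : Type*} {b : ι → H} (hb : Orthonormal ℂ b)
    (u v : H) (s : Finset ι) :
    ∑ i ∈ s, ‖⟪u, b i⟫ * ⟪b i, v⟫‖ ≤ ‖u‖ * ‖v‖ := by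
  have h1 : ∑ i ∈ s, ‖⟪u, b i⟫‖ ^ 2 ≤ ‖u‖ ^ 2 := by
    simp_rw [norm_inner_symm u]
    exact hb.sum_inner_products_le u
  have h2 : ∑ i ∈ s, ‖⟪b i, v⟫‖ ^ 2 ≤ ‖v‖ ^ 2 := hb.sum_inner_products_le v
  simp_rw [norm_mul]
  calc _ ≤ √(∑ i ∈ s, ‖⟪u, b i⟫‖ ^ 2) * √(∑ i ∈ s, ‖⟪b i, v⟫‖ ^ 2) :=
        Real.sum_mul_le_sqrt_mul_sqrt _ _ _
    _ ≤ ‖u‖ * ‖v‖ := by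
        gcongr
        · exact Real.sqrt_le_iff.2 ⟨norm_nonneg _, h1⟩
        · exact Real.sqrt_le_iff.2 ⟨norm_nonneg _, h2⟩

theorem pairing_eq_tsum {ι J : Type*} (b : HilbertBasis ι ℂ H) {T : H →L[ℂ] H} {x y : J → H}
    (h : IsNuclearRep T x y) (A : H →L[ℂ] H) :
    pairing b A T = ∑' j, ⟪y j, A (x j)⟫ := by
  have hi : ∀ i, ⟪b i, (A ∘L T) (b i)⟫ = ∑' j, ⟪y j, b i⟫ * ⟪b i, A (x j)⟫ := by
    intro i
    have := (h.hasSum (b i)).mapL ((innerSL ℂ (b i)).comp A)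
    simpa using this.tsum_eq.symm
  have hbd := fun j => sum_norm_inner_mul_inner_le b.orthonormal (y j) (A (x j))
  have hs : Summable fun p : J × ι => ⟪y p.1, b p.2⟫ * ⟪b p.2, A (x p.1)⟫ := by
    refine Summable.of_norm ?_
    rw [summable_prod_of_nonneg fun _ => norm_nonneg _]
    have h1 := fun j => summable_of_sum_le (fun _ => norm_nonneg _) (hbd j)
    refine ⟨h1, Summable.of_nonneg_of_le (fun j => tsum_nonneg fun _ => norm_nonneg _)
      (fun j => (h1 j).tsum_le_of_sum_le (hbd j)) ?_⟩
    refine Summable.of_nonneg_of_le (fun j => by positivity) (fun j => ?_) (h.1.mul_left ‖A‖)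
    calc ‖y j‖ * ‖A (x j)‖ ≤ ‖y j‖ * (‖A‖ * ‖x j‖) := by gcongr; exact A.le_opNorm _
      _ = ‖A‖ * (‖x j‖ * ‖y j‖) := by ring
  unfold pairing tr
  simp_rw [hi]
  rw [Summable.tsum_comm (f := fun j i => ⟪y j, b i⟫ * ⟪b i, A (x j)⟫) hs]
  exact tsum_congr fun j => b.tsum_inner_mul_inner _ _

theorem continuous_pairing {ι J : Type*} (b : HilbertBasis ι ℂ H) {T : H →L[ℂ] H} {x y : J → H}
    (h : IsNuclearRep T x y) : Continuous fun A => pairing b A T := by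
  let f : (H →L[ℂ] H) →ₗ[ℂ] ℂ :=
    { toFun := fun A => ∑' j, ⟪y j, A (x j)⟫
      map_add' := fun A B => by
        simp only [add_apply, inner_add_right]
        exact (summable_inner_apply h.1 A).tsum_add (summable_inner_apply h.1 B)
      map_smul' := fun c A => by
        simp only [smul_apply, inner_smul_right, tsum_mul_left, RingHom.id_apply, smul_eq_mul] }
  have hf : ∀ A, ‖f A‖ ≤ (∑' j, ‖x j‖ * ‖y j‖) * ‖A‖ := fun A => by
    rw [mul_comm, ← tsum_mul_left]
    refine tsum_of_norm_bounded (h.1.mul_left ‖A‖).hasSum fun j => ?_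
    calc ‖⟪y j, A (x j)⟫‖ ≤ ‖y j‖ * ‖A (x j)‖ := norm_inner_le_norm _ _
      _ ≤ ‖y j‖ * (‖A‖ * ‖x j‖) := by gcongr; exact A.le_opNorm _
      _ = ‖A‖ * (‖x j‖ * ‖y j‖) := by ring
  have : (fun A => pairing b A T) = f.mkContinuous _ hf := by
    ext A; simp [f, pairing_eq_tsum b h A]
  rw [this]
  exact ContinuousLinearMap.continuous _

theorem isNuclearRep_rankOne (x y : H) :
    IsNuclearRep (rankOne x y) (fun _ : Unit => x) (fun _ => y) :=
  ⟨(hasSum_fintype _).summable, fun z => by simp [rankOne_apply]⟩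

theorem isTraceClass_rankOne (x y : H) : IsTraceClass (rankOne x y) := by
  refine ⟨Pi.single 0 x, Pi.single 0 y, ?_, fun z => ?_⟩
  · refine summable_of_ne_finset_zero (s := {0}) fun n hn => ?_
    simp_all
  · rw [tsum_eq_single 0 fun n hn => by simp [hn]]
    simp [rankOne_apply]

theorem pairing_rankOne {ι : Type*} (b : HilbertBasis ι ℂ H) (A : H →L[ℂ] H) (x y : H) :
    pairing b A (rankOne x y) = ⟪y, A x⟫ := by
  simp [pairing_eq_tsum b (isNuclearRep_rankOne x y)]

theorem pairing_rankOne_left {ι : Type*} (b : HilbertBasis ι ℂ H) (T : H →L[ℂ] H) (x y : H) :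
    pairing b (rankOne x y) T = ⟪y, T x⟫ := by
  rw [← adjoint_inner_left, ← b.tsum_inner_mul_inner]
  simp [pairing, tr, rankOne_apply, adjoint_inner_left]

/-! ### Density of `alg(M', M)` for a factor `M` -/

theorem commute_starProjection {E : Type*} [NormedAddCommGroup E] [InnerProductSpace ℂ E]
    [CompleteSpace E] (V : Submodule ℂ E) (T : E →L[ℂ] E) (h1 : ∀ v ∈ V, T v ∈ V)
    (h2 : ∀ v ∈ V, adjoint T v ∈ V) (v : E) :
    V.topologicalClosure.starProjection (T v) = T (V.topologicalClosure.starProjection v) := by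
  have key : ∀ S : E →L[ℂ] E, (∀ v ∈ V, S v ∈ V) →
      ∀ v ∈ V.topologicalClosure, S v ∈ V.topologicalClosure := fun S hS v hv =>
    map_mem_closure S.continuous hv hS
  refine Submodule.eq_starProjection_of_mem_of_inner_eq_zero
    (key T h1 _ (Submodule.starProjection_apply_mem _ _)) fun w hw => ?_
  rw [← map_sub, ← adjoint_inner_right]
  exact Submodule.starProjection_inner_eq_zero _ _ (key _ h2 w hw)

/-- The ampliation `B ⊗ 1` on `ℓ²(J, H)`. -/
def amp (J : Type*) (B : H →L[ℂ] H) : lp (fun _ : J => H) 2 →L[ℂ] lp (fun _ : J => H) 2 :=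
  lp.mapCLM 2 (fun _ => B) (norm_nonneg B) fun _ => le_rfl

@[simp] theorem amp_apply {J : Type*} (B : H →L[ℂ] H) (x : lp (fun _ : J => H) 2) (j : J) :
    amp J B x j = B (x j) := rfl

theorem amp_mul {J : Type*} (A B : H →L[ℂ] H) (x : lp (fun _ : J => H) 2) :
    amp J (A * B) x = amp J A (amp J B x) := by
  ext j; simp

theorem adjoint_amp {J : Type*} (B : H →L[ℂ] H) : adjoint (amp J B) = amp J (star B) := by
  symm
  rw [eq_adjoint_iff]
  intro x y
  simp [lp.inner_eq_tsum, star_eq_adjoint, adjoint_inner_left]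

theorem amp_single {J : Type*} [DecidableEq J] (B : H →L[ℂ] H) (j : J) (v : H) :
    amp J B (lp.single 2 j v) = lp.single 2 j (B v) := by
  ext k
  by_cases h : k = j
  · subst h; simp
  · simp [lp.single_apply, h]

theorem commute_amp_of_factor {J : Type*} {M : VonNeumannAlgebra H} (hM : IsFactor M)
    (P : lp (fun _ : J => H) 2 →L[ℂ] lp (fun _ : J => H) 2)
    (h1 : ∀ B ∈ M, ∀ v, P (amp J B v) = amp J B (P v))
    (h2 : ∀ B ∈ M.commutant, ∀ v, P (amp J B v) = amp J B (P v))
    (A : H →L[ℂ] H) (v) : P (amp J A v) = amp J A (P v) := by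
  classical
  have hs : ∀ i j, ∃ c : ℂ, ∀ u : H, P (lp.single 2 j u) i = c • u := by
    intro i j
    let Q : H →L[ℂ] H := (lp.evalCLM ℂ (fun _ : J => H) 2 i) ∘L P ∘L
      (lp.singleContinuousLinearMap ℂ (fun _ : J => H) 2 j)
    have hQ : ∀ u, Q u = P (lp.single 2 j u) i := fun u => rfl
    have hc : ∀ B, (∀ v, P (amp J B v) = amp J B (P v)) → B * Q = Q * B := by
      intro B hB
      ext u
      simp [hQ, ← amp_single, hB]
    obtain ⟨c, hc⟩ := hM Q
      (by
        rw [← M.commutant_commutant, VonNeumannAlgebra.mem_commutant_iff]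
        exact fun B hB => hc B (h2 B hB))
      (VonNeumannAlgebra.mem_commutant_iff.2 fun B hB => hc B (h1 B hB))
    exact ⟨c, fun u => by rw [← hQ, hc]; simp⟩
  have hsingle : ∀ j u, P (amp J A (lp.single 2 j u)) = amp J A (P (lp.single 2 j u)) := by
    intro j u
    ext i
    obtain ⟨c, hc⟩ := hs i j
    simp [amp_single, hc]
  have hv := lp.hasSum_single (p := 2) (by simp) v
  have e1 := (hv.mapL (P ∘L amp J A))
  have e2 := (hv.mapL (amp J A ∘L P))
  simp only [comp_apply, hsingle] at e1 e2
  exact e1.unique e2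

theorem inner_amp_eq_zero {J : Type*} {M : VonNeumannAlgebra H} (hM : IsFactor M)
    (x y : lp (fun _ : J => H) 2)
    (h : ∀ C ∈ M.commutant, ∀ B ∈ M, ⟪y, amp J (C * B) x⟫ = 0) (A : H →L[ℂ] H) :
    ⟪y, amp J A x⟫ = 0 := by
  let V : Submodule ℂ (lp (fun _ : J => H) 2) :=
    Submodule.span ℂ {v | ∃ C ∈ M.commutant, ∃ B ∈ M, amp J (C * B) x = v}
  have hxV : x ∈ V := Submodule.subset_span ⟨1, one_mem _, 1, one_mem _, by ext; simp⟩
  have hyV : ∀ v ∈ V, ⟪y, v⟫ = 0 := by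
    intro v hv
    induction hv using Submodule.span_induction with
    | mem v hv => obtain ⟨C, hC, B, hB, rfl⟩ := hv; exact h C hC B hB
    | zero => simp
    | add u v _ _ hu hv => simp [hu, hv]
    | smul c v _ hv => simp [hv]
  have hinv : ∀ D : H →L[ℂ] H, (D ∈ M ∨ D ∈ M.commutant) → ∀ v ∈ V, amp J D v ∈ V := by
    intro D hD v hv
    induction hv using Submodule.span_induction with
    | mem v hv =>
      obtain ⟨C, hC, B, hB, rfl⟩ := hv
      refine Submodule.subset_span ?_
      rcases hD with hD | hD
      · refine ⟨C, hC, D * B, mul_mem hD hB, ?_⟩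
        rw [← amp_mul, ← mul_assoc, ← mul_assoc, VonNeumannAlgebra.mem_commutant_iff.1 hC D hD]
      · exact ⟨D * C, mul_mem hD hC, B, hB, by rw [← amp_mul, mul_assoc]⟩
    | zero => simp
    | add u v _ _ hu hv => rw [map_add]; exact add_mem hu hv
    | smul c v _ hv => rw [map_smul]; exact V.smul_mem c hv
  set P := V.topologicalClosure.starProjection
  have hcomm := commute_amp_of_factor (J := J) hM P
    (fun B hB v => commute_starProjection V _ (hinv B (.inl hB))
      (by rw [adjoint_amp]; exact hinv _ (.inl (star_mem hB))) v)
    (fun B hB v => commute_starProjection V _ (hinv B (.inr hB))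
      (by rw [adjoint_amp]; exact hinv _ (.inr (star_mem hB))) v) A x
  have hPx : P x = x :=
    Submodule.starProjection_eq_self_iff.2 (V.le_topologicalClosure hxV)
  rw [hPx] at hcomm
  have hmem : amp J A x ∈ V.topologicalClosure := by
    rw [← hcomm]; exact Submodule.starProjection_apply_mem _ _
  have hcl : IsClosed {v | ⟪y, v⟫ = 0} :=
    isClosed_eq (continuous_const.inner continuous_id) continuous_const
  exact closure_minimal hyV hcl hmem

theorem tsum_inner_eq_zero {J : Type*} {M : VonNeumannAlgebra H} (hM : IsFactor M)
    {x y : J → H} (hs : Summable fun j => ‖x j‖ * ‖y j‖)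
    (h : ∀ C ∈ M.commutant, ∀ B ∈ M, ∑' j, ⟪y j, (C * B) (x j)⟫ = 0) (A : H →L[ℂ] H) :
    ∑' j, ⟪y j, A (x j)⟫ = 0 := by
  let t : J → ℝ := fun j => √(‖y j‖ / ‖x j‖)
  have ht : ∀ j, t j ^ 2 = ‖y j‖ / ‖x j‖ := fun j => Real.sq_sqrt (by positivity)
  have hx : Memℓp (fun j => (t j : ℂ) • x j) 2 := by
    refine memℓp_gen (hs.congr fun j => ?_)
    simp only [ENNReal.toReal_ofNat, Real.rpow_ofNat, norm_smul, mul_pow, Complex.norm_real,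
      Real.norm_eq_abs, sq_abs, ht]
    by_cases h : x j = 0
    · simp [h]
    · have : ‖x j‖ ≠ 0 := by simpa using h
      field_simp
  have hy : Memℓp (fun j => ((t j)⁻¹ : ℂ) • y j) 2 := by
    refine memℓp_gen (hs.congr fun j => ?_)
    simp only [ENNReal.toReal_ofNat, Real.rpow_ofNat, norm_smul, mul_pow, Complex.norm_real,
      norm_inv, inv_pow, Real.norm_eq_abs, sq_abs, ht]
    by_cases h : y j = 0
    · simp [h]
    · have : ‖y j‖ ≠ 0 := by simpa using h
      field_simp
  have key : ∀ B : H →L[ℂ] H, ⟪(⟨_, hy⟩ : lp (fun _ : J => H) 2), amp J B ⟨_, hx⟩⟫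
      = ∑' j, ⟪y j, B (x j)⟫ := by
    intro B
    rw [lp.inner_eq_tsum]
    refine tsum_congr fun j => ?_
    simp only [amp_apply, map_smul, inner_smul_left, inner_smul_right, map_inv₀,
      Complex.conj_ofReal]
    by_cases h0 : t j = 0
    · have : ‖y j‖ / ‖x j‖ = 0 := by rw [← ht, h0]; simp
      rcases div_eq_zero_iff.1 this with h | h
      · simp [norm_eq_zero.1 h]
      · simp [norm_eq_zero.1 h]
    · have : (t j : ℂ) ≠ 0 := by exact_mod_cast h0
      field_simp
  rw [← key]
  exact inner_amp_eq_zero hM _ _ (fun C hC B hB => by rw [key]; exact h C hC B hB) A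

/-! ### Maps in `CB^σ_ε(M)` are `M'`-module maps -/

theorem map_commutant_mul {ι : Type*} {b : HilbertBasis ι ℂ H} {M : VonNeumannAlgebra H}
    (hM : IsFactor M) {φ Φ Φst : (H →L[ℂ] H) →ₗ[ℂ] (H →L[ℂ] H)} (hE : ExtendsTilde M φ Φ)
    (hN : IsNormalPair b Φ Φst) {C : H →L[ℂ] H} (hC : C ∈ M.commutant) (A : H →L[ℂ] H) :
    Φ (C * A) = C * Φ A := by
  refine ContinuousLinearMap.ext fun u => ext_inner_left ℂ fun v => ?_
  obtain ⟨x₁, y₁, h₁⟩ := hN.1 _ (isTraceClass_rankOne u v)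
  obtain ⟨x₂, y₂, h₂⟩ := hN.1 _ (isTraceClass_rankOne u (star C v))
  have e₁ : ∀ B, ⟪v, Φ (C * B) u⟫ = ∑' n, ⟪star C (y₁ n), B (x₁ n)⟫ := fun B => by
    rw [← pairing_rankOne b, hN.2 _ _ (isTraceClass_rankOne _ _), pairing_eq_tsum b h₁]
    simp [star_eq_adjoint, adjoint_inner_left]
  have e₂ : ∀ B, ⟪v, (C * Φ B) u⟫ = ∑' n, ⟪y₂ n, B (x₂ n)⟫ := fun B => by
    rw [← pairing_eq_tsum b h₂, ← hN.2 _ _ (isTraceClass_rankOne _ _), pairing_rankOne b]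
    simp [star_eq_adjoint, adjoint_inner_left]
  have s₁ : Summable fun n => ‖x₁ n‖ * ‖star C (y₁ n)‖ := by
    refine Summable.of_nonneg_of_le (fun n => by positivity) (fun n => ?_) (h₁.1.mul_left ‖star C‖)
    calc ‖x₁ n‖ * ‖star C (y₁ n)‖ ≤ ‖x₁ n‖ * (‖star C‖ * ‖y₁ n‖) := by
          gcongr; exact (star C).le_opNorm _
      _ = ‖star C‖ * (‖x₁ n‖ * ‖y₁ n‖) := by ring
  let x : ℕ ⊕ ℕ → H := Sum.elim x₁ x₂
  let y : ℕ ⊕ ℕ → H := Sum.elim (fun n => star C (y₁ n)) fun n => -y₂ n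
  have hs : Summable fun j => ‖x j‖ * ‖y j‖ :=
    (HasSum.sum (f := fun j => ‖x j‖ * ‖y j‖) s₁.hasSum
      (by simpa [Function.comp_def, x, y] using h₂.1.hasSum)).summable
  have hval : ∀ B, ∑' j, ⟪y j, B (x j)⟫ = ⟪v, Φ (C * B) u⟫ - ⟪v, (C * Φ B) u⟫ := fun B => by
    rw [e₁, e₂, sub_eq_add_neg]
    refine (HasSum.sum (f := fun j => ⟪y j, B (x j)⟫) (summable_inner_apply s₁ B).hasSum ?_).tsum_eq
    simpa [Function.comp_def, x, y] using (summable_inner_apply h₂.1 B).hasSum.neg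
  have := tsum_inner_eq_zero hM hs (fun C' hC' B hB => by
    rw [hval, ← mul_assoc, hE _ (mul_mem hC hC') _ hB, hE _ hC' _ hB, mul_assoc, sub_self]) A
  rwa [hval, sub_eq_zero] at this

theorem IsNormalPair.exists_bound {ι : Type*} {b : HilbertBasis ι ℂ H}
    {Φ Φst : (H →L[ℂ] H) →ₗ[ℂ] (H →L[ℂ] H)} (hN : IsNormalPair b Φ Φst) :
    ∃ K : ℝ, ∀ A, ‖Φ A‖ ≤ K * ‖A‖ := by
  have hc : Continuous Φ := by
    refine Φ.continuous_of_seq_closed_graph fun A A₀ B hA hB => ?_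
    refine ContinuousLinearMap.ext fun u => ext_inner_left ℂ fun v => ?_
    obtain ⟨x, y, h⟩ := hN.1 _ (isTraceClass_rankOne u v)
    have e : ∀ B, ⟪v, Φ B u⟫ = pairing b B (Φst (rankOne u v)) := fun B => by
      rw [← hN.2 _ _ (isTraceClass_rankOne _ _), pairing_rankOne]
    have l₁ : Filter.Tendsto (fun n => ⟪v, Φ (A n) u⟫) Filter.atTop (nhds ⟪v, Φ A₀ u⟫) := by
      simp_rw [e]
      exact ((continuous_pairing b h).tendsto _).comp hA
    have l₂ : Filter.Tendsto (fun n => ⟪v, Φ (A n) u⟫) Filter.atTop (nhds ⟪v, B u⟫) :=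
      (show Continuous fun T : H →L[ℂ] H => ⟪v, T u⟫ by fun_prop).tendsto B |>.comp hB
    exact tendsto_nhds_unique l₂ l₁
  exact ⟨‖(⟨Φ, hc⟩ : (H →L[ℂ] H) →L[ℂ] (H →L[ℂ] H))‖, fun A =>
    (⟨Φ, hc⟩ : (H →L[ℂ] H) →L[ℂ] (H →L[ℂ] H)).le_opNorm A⟩

/-! ### Cyclic and separating vectors -/

/-- A von Neumann algebra as a linear subspace of `B(H)`. -/
def toSubmodule (M : VonNeumannAlgebra H) : Submodule ℂ (H →L[ℂ] H) :=
  M.toStarSubalgebra.toSubalgebra.toSubmodule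

theorem mem_toSubmodule {M : VonNeumannAlgebra H} {A : H →L[ℂ] H} :
    A ∈ toSubmodule M ↔ A ∈ M := Iff.rfl

theorem smul_mem_vonNeumann {M : VonNeumannAlgebra H} {A : H →L[ℂ] H} (c : ℂ) (hA : A ∈ M) :
    c • A ∈ M :=
  (toSubmodule M).smul_mem c hA

theorem mem_of_commute {M : VonNeumannAlgebra H} {A : H →L[ℂ] H}
    (h : ∀ C ∈ M.commutant, C * A = A * C) : A ∈ M := by
  rw [← M.commutant_commutant]
  exact VonNeumannAlgebra.mem_commutant_iff.2 h

theorem commute_of_mem {M : VonNeumannAlgebra H} {A C : H →L[ℂ] H} (hA : A ∈ M)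
    (hC : C ∈ M.commutant) : A * C = C * A :=
  VonNeumannAlgebra.mem_commutant_iff.1 hC A hA

theorem isClosed_vonNeumann (M : VonNeumannAlgebra H) : IsClosed (M : Set (H →L[ℂ] H)) := by
  rw [← M.centralizer_centralizer]
  exact Set.isClosed_centralizer _

/-- The orbit map `A ↦ A x` on a von Neumann algebra. -/
def orbitMap (M : VonNeumannAlgebra H) (x : H) : toSubmodule M →ₗ[ℂ] H :=
  (ContinuousLinearMap.apply ℂ H x).toLinearMap ∘ₗ (toSubmodule M).subtype

theorem Cyclic.denseRange {M : VonNeumannAlgebra H} {x0 : H} (h : Cyclic M x0) :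
    DenseRange (orbitMap M x0) := by
  refine h.mono ?_
  rintro y ⟨A, hA, rfl⟩
  exact ⟨⟨A, hA⟩, rfl⟩

theorem Cyclic.eq_of_eqOn {M : VonNeumannAlgebra H} {x0 : H} (h : Cyclic M x0)
    {S T : H →L[ℂ] H} (hST : ∀ A ∈ M, S (A x0) = T (A x0)) : S = T := by
  refine ContinuousLinearMap.ext fun y => ?_
  refine congrFun (S.continuous.ext_on h T.continuous ?_) y
  rintro _ ⟨A, hA, rfl⟩
  exact hST A hA

theorem Separating.cyclic_commutant {M : VonNeumannAlgebra H} {x0 : H} (h : Separating M x0) :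
    Cyclic M.commutant x0 := by
  let V := LinearMap.range (orbitMap M.commutant x0)
  have hV : ∀ C ∈ M.commutant, ∀ v ∈ V, C v ∈ V := by
    rintro C hC _ ⟨D, rfl⟩
    have hCD : C * (D : H →L[ℂ] H) ∈ M.commutant := mul_mem hC (mem_toSubmodule.1 D.2)
    exact ⟨⟨_, hCD⟩, rfl⟩
  set P := V.topologicalClosure.starProjection
  have hP : P ∈ M := mem_of_commute fun C hC => by
    ext v
    exact (commute_starProjection V C (hV C hC) (hV _ (star_mem hC)) v).symm
  have hx : x0 ∈ V := ⟨⟨1, one_mem M.commutant⟩, rfl⟩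
  have hPx : P x0 = x0 := Submodule.starProjection_eq_self_iff.2 (V.le_topologicalClosure hx)
  have h1 : (1 - P) = 0 := h _ (sub_mem (one_mem M) hP) (by simp [hPx])
  intro y
  have hy : y ∈ V.topologicalClosure := by
    have : P y = y := by
      have h2 : y - P y = 0 := DFunLike.congr_fun h1 y
      exact (sub_eq_zero.1 h2).symm
    rw [← this]
    exact Submodule.starProjection_apply_mem _ _
  refine closure_mono ?_ hy
  rintro _ ⟨C, rfl⟩
  exact ⟨C, C.2, rfl⟩

theorem exists_apply_eq_of_bound {M : VonNeumannAlgebra H} {x0 : H} (h : Separating M x0)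
    {z : H} {K : ℝ} (hK : ∀ C ∈ M.commutant, ‖C z‖ ≤ K * ‖C x0‖) : ∃ A ∈ M, A x0 = z := by
  have hc := h.cyclic_commutant
  let A := (orbitMap M.commutant z).extendOfNorm (orbitMap M.commutant x0)
  have hA : ∀ C ∈ M.commutant, A (C x0) = C z := fun C hC =>
    LinearMap.extendOfNorm_eq hc.denseRange ⟨K, fun C => hK C C.2⟩ ⟨C, hC⟩
  refine ⟨A, mem_of_commute fun C hC => hc.eq_of_eqOn fun D hD => ?_, ?_⟩
  · simpa [hA D hD] using (hA (C * D) (mul_mem hC hD)).symm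
  · simpa using hA 1 (one_mem _)

theorem surjective_orbit_of_surjective_C {ι : Type*} (b : HilbertBasis ι ℂ H)
    {M : VonNeumannAlgebra H} (hM : IsFactor M) {x0 : H} (hsep : Separating M x0)
    (h : ∃ φ Φ Φst : (H →L[ℂ] H) →ₗ[ℂ] (H →L[ℂ] H),
      ExtendsTilde M φ Φ ∧ IsNormalPair b Φ Φst ∧ Φ (rankOne x0 x0) = 1) (z : H) :
    ∃ A ∈ M, A x0 = z := by
  obtain ⟨φ, Φ, Φst, hE, hN, h1⟩ := h
  obtain ⟨K, hK⟩ := hN.exists_bound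
  refine exists_apply_eq_of_bound hsep (K := K * ‖x0‖ * ‖z‖) fun C hC => ?_
  have := hK (C * rankOne x0 x0)
  rw [map_commutant_mul hM hE hN hC, h1, mul_one, mul_rankOne, norm_rankOne] at this
  calc ‖C z‖ ≤ ‖C‖ * ‖z‖ := C.le_opNorm z
    _ ≤ (K * (‖C x0‖ * ‖x0‖)) * ‖z‖ := by gcongr
    _ = K * ‖x0‖ * ‖z‖ * ‖C x0‖ := by ring

theorem exists_apply_eq_of_D {ι : Type*} (b : HilbertBasis ι ℂ H)
    {M : VonNeumannAlgebra H} (hM : IsFactor M) {x0 : H} (hx0 : ‖x0‖ = 1) (hsep : Separating M x0)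
    {z : H} (h : ∃ φ Φ Φst : (H →L[ℂ] H) →ₗ[ℂ] (H →L[ℂ] H),
      ExtendsTilde M φ Φ ∧ IsNormalPair b Φ Φst ∧ Φst (rankOne x0 x0) = rankOne x0 z) :
    ∃ A ∈ M, A x0 = z := by
  obtain ⟨φ, Φ, Φst, hE, hN, hz⟩ := h
  obtain ⟨K, hK⟩ := hN.exists_bound
  have key : ∀ A, ⟪x0, Φ A x0⟫ = ⟪z, A x0⟫ := fun A => by
    rw [← pairing_rankOne b, hN.2 _ _ (isTraceClass_rankOne _ _), hz, pairing_rankOne]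
  refine exists_apply_eq_of_bound hsep (K := K) fun C hC => ?_
  have h1 : ⟪C x0, Φ (rankOne (C z) x0) x0⟫ = (‖C z‖ : ℂ) ^ 2 := by
    have := key (star C * rankOne (C z) x0)
    rw [map_commutant_mul hM hE hN (star_mem hC)] at this
    simpa [star_eq_adjoint, adjoint_inner_right, rankOne_apply, hx0, inner_smul_right,
      inner_self_eq_norm_sq_to_K] using this
  have h2 : ‖C z‖ ^ 2 ≤ ‖C x0‖ * (K * ‖C z‖) := by
    calc ‖C z‖ ^ 2 = ‖⟪C x0, Φ (rankOne (C z) x0) x0⟫‖ := by rw [h1]; simp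
      _ ≤ ‖C x0‖ * ‖Φ (rankOne (C z) x0) x0‖ := norm_inner_le_norm _ _
      _ ≤ ‖C x0‖ * (‖Φ (rankOne (C z) x0)‖ * ‖x0‖) := by gcongr; exact le_opNorm _ _
      _ ≤ ‖C x0‖ * (K * ‖C z‖) := by
        have := hK (rankOne (C z) x0)
        rw [norm_rankOne, hx0, mul_one] at this
        rw [hx0, mul_one]; gcongr
  rcases (norm_nonneg (C z)).eq_or_lt with h0 | h0
  · have hK0 : 0 ≤ K := by
      have := (norm_nonneg _).trans (hK (rankOne x0 x0))
      rwa [norm_rankOne, hx0, one_mul, mul_one] at this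
    rw [← h0]; positivity
  · nlinarith

theorem exists_orbit_inverse {N : VonNeumannAlgebra H} {x0 : H} (hsep : Separating N x0)
    (hsurj : ∀ y : H, ∃ A ∈ N, A x0 = y) :
    ∃ r : H →ₗ[ℂ] (H →L[ℂ] H), (∀ y, r y ∈ N) ∧ (∀ y, r y x0 = y) ∧ ∀ A ∈ N, r (A x0) = A := by
  have hinj : ∀ A ∈ N, ∀ B ∈ N, A x0 = B x0 → A = B := fun A hA B hB h =>
    sub_eq_zero.1 (hsep _ (sub_mem hA hB) (by simp [h]))
  choose r hr hrx using hsurj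
  refine ⟨⟨⟨r, fun u v => ?_⟩, fun c v => ?_⟩, hr, hrx, fun A hA => hinj _ (hr _) _ hA (hrx _)⟩
  · exact hinj _ (hr _) _ (add_mem (hr _) (hr _)) (by simp [hrx])
  · exact hinj _ (hr _) _ (smul_mem_vonNeumann c (hr _)) (by simp [hrx])

theorem exists_norm_le_of_surjective {M : VonNeumannAlgebra H} {x0 : H} (hsep : Separating M x0)
    (hsurj : ∀ y : H, ∃ A ∈ M, A x0 = y) : ∃ K : ℝ, ∀ A ∈ M, ‖A‖ ≤ K * ‖A x0‖ := by
  obtain ⟨r, hr, hrx, hri⟩ := exists_orbit_inverse hsep hsurj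
  have hc : Continuous r := by
    refine r.continuous_of_seq_closed_graph fun u y B hu hB => ?_
    have hBM : B ∈ M := (isClosed_vonNeumann M).mem_of_tendsto hB (.of_forall fun n => hr _)
    have hBx : Filter.Tendsto (fun n => r (u n) x0) Filter.atTop (nhds (B x0)) :=
      (show Continuous fun T : H →L[ℂ] H => T x0 by fun_prop).tendsto B |>.comp hB
    simp_rw [hrx] at hBx
    rw [← hri B hBM, tendsto_nhds_unique hBx hu]
  refine ⟨‖(⟨r, hc⟩ : H →L[ℂ] (H →L[ℂ] H))‖, fun A hA => ?_⟩
  have := (⟨r, hc⟩ : H →L[ℂ] (H →L[ℂ] H)).le_opNorm (A x0)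
  rwa [show (⟨r, hc⟩ : H →L[ℂ] (H →L[ℂ] H)) (A x0) = A from hri A hA] at this

/-! ### Finite orthogonal families in `M` -/

/-- A finite family of nonzero self-adjoint elements of `M` with pairwise zero products. -/
def IsOrthoFamily (M : VonNeumannAlgebra H) (s : Finset (H →L[ℂ] H)) : Prop :=
  (∀ p ∈ s, p ∈ M ∧ IsSelfAdjoint p ∧ p ≠ 0) ∧ ∀ p ∈ s, ∀ q ∈ s, p ≠ q → p * q = 0

theorem eq_zero_of_mul_self {A : H →L[ℂ] H} (hA : IsSelfAdjoint A) (h : A * A = 0) : A = 0 := by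
  rw [← CStarRing.star_mul_self_eq_zero_iff, hA.star_eq, h]

theorem mul_eq_zero_symm {A B : H →L[ℂ] H} (hA : IsSelfAdjoint A) (hB : IsSelfAdjoint B)
    (h : A * B = 0) : B * A = 0 := by
  simpa [hA.star_eq, hB.star_eq] using congrArg star h

theorem IsOrthoFamily.insert [DecidableEq (H →L[ℂ] H)] {M : VonNeumannAlgebra H}
    {s : Finset (H →L[ℂ] H)} (hs : IsOrthoFamily M s) {c : H →L[ℂ] H} (hc : c ∈ M)
    (hsa : IsSelfAdjoint c) (h0 : c ≠ 0) (h : ∀ p ∈ s, c * p = 0) :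
    IsOrthoFamily M (insert c s) ∧ (insert c s).card = s.card + 1 := by
  refine ⟨⟨fun p hp => ?_, fun p hp q hq hpq => ?_⟩, Finset.card_insert_of_notMem fun hcs =>
    h0 (eq_zero_of_mul_self hsa (h c hcs))⟩
  · rcases Finset.mem_insert.1 hp with rfl | hp
    · exact ⟨hc, hsa, h0⟩
    · exact hs.1 p hp
  · rcases Finset.mem_insert.1 hp with rfl | hp' <;> rcases Finset.mem_insert.1 hq with rfl | hq'
    · exact absurd rfl hpq
    · exact h q hq'
    · exact mul_eq_zero_symm hsa (hs.1 p hp').2.1 (h p hp')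
    · exact hs.2 p hp' q hq' hpq

theorem IsOrthoFamily.erase [DecidableEq (H →L[ℂ] H)] {M : VonNeumannAlgebra H}
    {s : Finset (H →L[ℂ] H)} (hs : IsOrthoFamily M s) (b : H →L[ℂ] H) :
    IsOrthoFamily M (s.erase b) :=
  ⟨fun p hp => hs.1 p (Finset.mem_of_mem_erase hp), fun p hp q hq =>
    hs.2 p (Finset.mem_of_mem_erase hp) q (Finset.mem_of_mem_erase hq)⟩

theorem norm_sum_sq_of_orthogonal {J : Type*} (s : Finset J) (w : J → H)
    (h : ∀ p ∈ s, ∀ q ∈ s, p ≠ q → ⟪w p, w q⟫ = 0) :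
    ‖∑ p ∈ s, w p‖ ^ 2 = ∑ p ∈ s, ‖w p‖ ^ 2 := by
  have : ⟪∑ p ∈ s, w p, ∑ p ∈ s, w p⟫ = ∑ p ∈ s, ⟪w p, w p⟫ := by
    simp_rw [sum_inner, inner_sum]
    exact Finset.sum_congr rfl fun p hp =>
      Finset.sum_eq_single_of_mem p hp fun q hq hqp => h p hp q hq hqp.symm
  simp_rw [inner_self_eq_norm_sq_to_K] at this
  exact_mod_cast this

theorem IsOrthoFamily.card_le {M : VonNeumannAlgebra H} {s : Finset (H →L[ℂ] H)}
    (hs : IsOrthoFamily M s) {x0 : H} (hx0 : ‖x0‖ = 1) {K : ℝ}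
    (hK : ∀ A ∈ M, ‖A‖ ≤ K * ‖A x0‖) : (s.card : ℝ) ≤ K ^ 2 := by
  let e : (H →L[ℂ] H) → (H →L[ℂ] H) := fun p => ((‖p‖⁻¹ : ℝ) : ℂ) • p
  have hsa : ∀ p ∈ s, ∀ u v, ⟪e p u, v⟫ = ⟪u, e p v⟫ := fun p hp u v => by
    have := (hs.1 p hp).2.1.isSymmetric u v
    simp only [e, smul_apply, inner_smul_left, inner_smul_right, Complex.conj_ofReal]
    exact congrArg _ this
  have hn : ∀ p ∈ s, ‖e p‖ = 1 := fun p hp => by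
    have : ‖p‖ ≠ 0 := norm_ne_zero_iff.2 (hs.1 p hp).2.2
    simp [e, norm_smul, this]
  have ho : ∀ p ∈ s, ∀ q ∈ s, p ≠ q → ∀ v, e p (e q v) = 0 := fun p hp q hq hpq v => by
    have : p (q v) = 0 := DFunLike.congr_fun (hs.2 p hp q hq hpq) v
    simp [e, this]
  have hv : ∀ p ∈ s, 1 ≤ K ^ 2 * ‖e p x0‖ ^ 2 := fun p hp => by
    have := hK (e p) (smul_mem_vonNeumann _ (hs.1 p hp).1)
    rw [hn p hp] at this
    rw [← mul_pow]
    exact one_le_pow₀ this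
  set S := ∑ p ∈ s, ‖e p x0‖ ^ 2
  have hw : ‖∑ p ∈ s, e p (e p x0)‖ ^ 2 ≤ S := by
    rw [norm_sum_sq_of_orthogonal s _ fun p hp q hq hpq => by
      rw [hsa p hp, ho p hp q hq hpq, inner_zero_right]]
    refine Finset.sum_le_sum fun p hp => ?_
    have := (e p).le_opNorm (e p x0)
    rw [hn p hp, one_mul] at this
    gcongr
  have hS : S ≤ ‖∑ p ∈ s, e p (e p x0)‖ := by
    have h1 : ((S : ℝ) : ℂ) = ⟪x0, ∑ p ∈ s, e p (e p x0)⟫ := by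
      rw [inner_sum, Complex.ofReal_sum]
      refine Finset.sum_congr rfl fun p hp => ?_
      rw [← hsa p hp, inner_self_eq_norm_sq_to_K]
      simp
    calc S ≤ ‖((S : ℝ) : ℂ)‖ := by rw [Complex.norm_real]; exact le_abs_self _
      _ ≤ ‖x0‖ * _ := by rw [h1]; exact norm_inner_le_norm _ _
      _ = _ := by rw [hx0, one_mul]
  have hS0 : 0 ≤ S := by positivity
  have hS1 : S ≤ 1 := by nlinarith
  calc (s.card : ℝ) = ∑ p ∈ s, (1 : ℝ) := by simp
    _ ≤ ∑ p ∈ s, K ^ 2 * ‖e p x0‖ ^ 2 := Finset.sum_le_sum hv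
    _ = K ^ 2 * S := by rw [Finset.mul_sum]
    _ ≤ K ^ 2 := by nlinarith [sq_nonneg K]

theorem exists_maximal_isOrthoFamily {M : VonNeumannAlgebra H} {x0 : H} (hx0 : ‖x0‖ = 1) {K : ℝ}
    (hK : ∀ A ∈ M, ‖A‖ ≤ K * ‖A x0‖) :
    ∃ s, IsOrthoFamily M s ∧ ∀ t, IsOrthoFamily M t → t.card ≤ s.card := by
  let N : Set ℕ := {n | ∃ s, IsOrthoFamily M s ∧ s.card = n}
  have hne : N.Nonempty := ⟨0, ∅, ⟨by simp, by simp⟩, rfl⟩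
  have hbdd : BddAbove N := ⟨⌊K ^ 2⌋₊, by
    rintro _ ⟨s, hs, rfl⟩
    exact Nat.le_floor (hs.card_le hx0 hK)⟩
  obtain ⟨s, hs, hcard⟩ := Nat.sSup_mem hne hbdd
  exact ⟨s, hs, fun t ht => hcard ▸ le_csSup hbdd ⟨t, ht, rfl⟩⟩

section Maximal

variable {M : VonNeumannAlgebra H} {s : Finset (H →L[ℂ] H)}

theorem IsOrthoFamily.eq_zero_of_maximal (hs : IsOrthoFamily M s)
    (hmax : ∀ t, IsOrthoFamily M t → t.card ≤ s.card) {c : H →L[ℂ] H} (hc : c ∈ M)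
    (hsa : IsSelfAdjoint c) (h : ∀ p ∈ s, c * p = 0) : c = 0 := by
  classical
  by_contra h0
  obtain ⟨h1, h2⟩ := hs.insert hc hsa h0 h
  have := hmax _ h1
  omega

theorem IsOrthoFamily.eq_zero_or_of_maximal (hs : IsOrthoFamily M s)
    (hmax : ∀ t, IsOrthoFamily M t → t.card ≤ s.card) {b : H →L[ℂ] H} (hb : b ∈ s)
    {c d : H →L[ℂ] H} (hc : c ∈ M) (hd : d ∈ M)
    (hcsa : IsSelfAdjoint c) (hdsa : IsSelfAdjoint d) (hcd : c * d = 0)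
    (hcs : ∀ p ∈ s, p ≠ b → c * p = 0) (hds : ∀ p ∈ s, p ≠ b → d * p = 0) : c = 0 ∨ d = 0 := by
  classical
  by_contra! h0
  obtain ⟨h1, h2⟩ := (hs.erase b).insert hd hdsa h0.2 fun p hp =>
    hds p (Finset.mem_of_mem_erase hp) (Finset.ne_of_mem_erase hp)
  obtain ⟨h3, h4⟩ := h1.insert hc hcsa h0.1 fun p hp => by
    rcases Finset.mem_insert.1 hp with rfl | hp
    · exact hcd
    · exact hcs p (Finset.mem_of_mem_erase hp) (Finset.ne_of_mem_erase hp)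
  have := hmax _ h3
  have := Finset.card_erase_add_one hb
  omega

theorem posPart_mem {x : H →L[ℂ] H} (hx : x ∈ M) : x⁺ ∈ M := by
  refine mem_of_commute fun C hC => ?_
  by_cases hsa : IsSelfAdjoint x
  · rw [CFC.posPart_def]
    exact (Commute.cfcₙ_real (show Commute x C from commute_of_mem hx hC) _).eq.symm
  · rw [CFC.posPart_def, cfcₙ_apply_of_not_predicate _ hsa]; simp

theorem posPart_mul_eq_zero {x p : H →L[ℂ] H} (hx : IsSelfAdjoint x) (h : x * p = 0) :
    x⁺ * p = 0 := by
  have h1 : x⁺ * x = x⁺ * x⁺ := by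
    nth_rw 2 [← CFC.posPart_sub_negPart x hx]
    rw [mul_sub, CFC.posPart_mul_negPart, sub_zero]
  have hsa : IsSelfAdjoint x⁺ := .of_nonneg (CFC.posPart_nonneg x)
  rw [← CStarRing.star_mul_self_eq_zero_iff, star_mul, hsa.star_eq, mul_assoc, ← mul_assoc x⁺,
    ← h1, mul_assoc x⁺, h]
  simp

theorem IsOrthoFamily.nonpos_or_nonneg_of_maximal (hs : IsOrthoFamily M s)
    (hmax : ∀ t, IsOrthoFamily M t → t.card ≤ s.card) {b : H →L[ℂ] H} (hb : b ∈ s)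
    {x : H →L[ℂ] H} (hx : x ∈ M) (hsa : IsSelfAdjoint x) (h : ∀ p ∈ s, p ≠ b → x * p = 0) :
    x ≤ 0 ∨ 0 ≤ x := by
  rw [← CFC.posPart_eq_zero_iff x hsa, ← CFC.negPart_eq_zero_iff x hsa]
  rw [← CFC.posPart_neg]
  refine hs.eq_zero_or_of_maximal hmax hb (posPart_mem hx) (posPart_mem (neg_mem hx))
    (.of_nonneg (CFC.posPart_nonneg _)) (.of_nonneg (CFC.posPart_nonneg _)) ?_
    (fun p hp hpb => posPart_mul_eq_zero hsa (h p hp hpb))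
    (fun p hp hpb => posPart_mul_eq_zero hsa.neg (by simp [h p hp hpb]))
  rw [CFC.posPart_neg, CFC.posPart_mul_negPart]

theorem IsOrthoFamily.exists_eq_smul_of_maximal (hs : IsOrthoFamily M s)
    (hmax : ∀ t, IsOrthoFamily M t → t.card ≤ s.card) {b : H →L[ℂ] H} (hb : b ∈ s)
    {a : H →L[ℂ] H} (ha : a ∈ M) (hsa : IsSelfAdjoint a) (h : ∀ p ∈ s, p ≠ b → a * p = 0) :
    ∃ l : ℝ, a = (l : ℂ) • (b * b) := by
  obtain ⟨hbM, hbsa, hb0⟩ := hs.1 b hb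
  have hdich : ∀ l : ℝ, a ≤ (l : ℂ) • (b * b) ∨ (l : ℂ) • (b * b) ≤ a := fun l => by
    have := hs.nonpos_or_nonneg_of_maximal hmax hb (x := a - (l : ℂ) • (b * b))
      (sub_mem ha (smul_mem_vonNeumann _ (mul_mem hbM hbM)))
      (hsa.sub (by
        rw [isSelfAdjoint_iff, star_smul, star_mul, hbsa.star_eq]; simp))
      (fun p hp hpb => by
        rw [sub_mul, h p hp hpb, smul_mul_assoc, mul_assoc, hs.2 b hb p hp hpb.symm]; simp)
    rwa [sub_nonpos, sub_nonneg] at this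
  obtain ⟨v, hv⟩ : ∃ v, b v ≠ 0 := by
    by_contra! h0
    exact hb0 (ContinuousLinearMap.ext h0)
  have hf : ∀ {A B : H →L[ℂ] H}, A ≤ B → RCLike.re ⟪v, A v⟫ ≤ RCLike.re ⟪v, B v⟫ := fun hAB => by
    have := (ContinuousLinearMap.le_def _ _).1 hAB |>.re_inner_nonneg_right v
    simpa [inner_sub_right] using this
  have hfb : ∀ l : ℝ, RCLike.re ⟪v, ((l : ℂ) • (b * b)) v⟫ = l * ‖b v‖ ^ 2 := fun l => by
    have : ⟪v, b (b v)⟫ = ((‖b v‖ ^ 2 : ℝ) : ℂ) := by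
      rw [← hbsa.isSymmetric.apply_clm, inner_self_eq_norm_sq_to_K]; simp
    simp only [smul_apply, mul_apply_eq_comp, inner_smul_right, this]
    rw [← Complex.ofReal_mul]; exact Complex.ofReal_re _
  have hpos : 0 < ‖b v‖ ^ 2 := by positivity
  let l₀ : ℝ := RCLike.re ⟪v, a v⟫ / ‖b v‖ ^ 2
  have hl₀ : l₀ * ‖b v‖ ^ 2 = RCLike.re ⟪v, a v⟫ := by simp only [l₀]; field_simp
  have hcont : Continuous fun l : ℝ => (l : ℂ) • (b * b) :=
    (Complex.continuous_ofReal).smul continuous_const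
  refine ⟨l₀, le_antisymm ?_ ?_⟩
  · have : Set.Ioi l₀ ⊆ {l : ℝ | a ≤ (l : ℂ) • (b * b)} := fun l hl =>
      (hdich l).resolve_right fun hle => by
        have := hf hle
        rw [hfb, ← hl₀] at this
        exact absurd (le_of_mul_le_mul_right this hpos) (not_le.2 hl)
    exact closure_minimal this (isClosed_le continuous_const hcont)
      (by rw [closure_Ioi]; exact Set.self_mem_Ici)
  · have : Set.Iio l₀ ⊆ {l : ℝ | (l : ℂ) • (b * b) ≤ a} := fun l hl =>
      (hdich l).resolve_left fun hle => by
        have := hf hle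
        rw [hfb, ← hl₀] at this
        exact absurd (le_of_mul_le_mul_right this hpos) (not_le.2 hl)
    exact closure_minimal this (isClosed_le hcont continuous_const)
      (by rw [closure_Iio]; exact Set.self_mem_Iic)

theorem IsOrthoFamily.exists_mul_self_eq_smul_of_maximal (hs : IsOrthoFamily M s)
    (hmax : ∀ t, IsOrthoFamily M t → t.card ≤ s.card) {b : H →L[ℂ] H} (hb : b ∈ s) :
    ∃ c : ℝ, c ≠ 0 ∧ b * b = (c : ℂ) • b := by
  obtain ⟨hbM, hbsa, hb0⟩ := hs.1 b hb
  obtain ⟨c, hc⟩ := hs.exists_eq_smul_of_maximal hmax hb (a := b * b * b)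
    (mul_mem (mul_mem hbM hbM) hbM)
    (by rw [isSelfAdjoint_iff]; simp [hbsa.star_eq, mul_assoc])
    (fun p hp hpb => by rw [mul_assoc, hs.2 b hb p hp hpb.symm, mul_zero])
  have ht : b * b - (c : ℂ) • b = 0 := by
    refine eq_zero_of_mul_self ?_ ?_
    · rw [isSelfAdjoint_iff]; simp [hbsa.star_eq]
    · have : (b * b - (c : ℂ) • b) * b = 0 := by rw [sub_mul, hc, smul_mul_assoc, sub_self]
      rw [mul_sub, mul_smul_comm, ← mul_assoc, this]; simp
  rw [sub_eq_zero] at ht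
  refine ⟨c, fun h0 => hb0 (eq_zero_of_mul_self hbsa ?_), ht⟩
  rw [ht, h0]; simp

theorem IsOrthoFamily.exists_corner_of_maximal (hs : IsOrthoFamily M s)
    (hmax : ∀ t, IsOrthoFamily M t → t.card ≤ s.card) {b : H →L[ℂ] H} (hb : b ∈ s)
    {y : H →L[ℂ] H} (hy : y ∈ M) : ∃ z : ℂ, b * y * b = z • b := by
  obtain ⟨hbM, hbsa, hb0⟩ := hs.1 b hb
  obtain ⟨c, -, hc⟩ := hs.exists_mul_self_eq_smul_of_maximal hmax hb
  have key : ∀ a ∈ M, IsSelfAdjoint a → ∃ z : ℂ, b * a * b = z • b := fun a ha hsa => by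
    obtain ⟨l, hl⟩ := hs.exists_eq_smul_of_maximal hmax hb (a := b * a * b)
      (mul_mem (mul_mem hbM ha) hbM)
      (by rw [isSelfAdjoint_iff]; simp [hbsa.star_eq, hsa.star_eq, mul_assoc])
      (fun p hp hpb => by rw [mul_assoc, hs.2 b hb p hp hpb.symm, mul_zero])
    exact ⟨l * c, by rw [hl, hc, smul_smul]⟩
  have hre : (realPart y : H →L[ℂ] H) ∈ M := by
    rw [realPart_apply_coe]
    have := smul_mem_vonNeumann (((2 : ℝ)⁻¹ : ℝ) : ℂ) (add_mem hy (star_mem hy))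
    rwa [Complex.coe_smul] at this
  have him : (imaginaryPart y : H →L[ℂ] H) ∈ M := by
    rw [imaginaryPart_apply_coe]
    have := smul_mem_vonNeumann (-Complex.I * (((2 : ℝ)⁻¹ : ℝ) : ℂ)) (sub_mem hy (star_mem hy))
    rwa [mul_smul, Complex.coe_smul] at this
  obtain ⟨z₁, h₁⟩ := key _ hre (realPart y).2
  obtain ⟨z₂, h₂⟩ := key _ him (imaginaryPart y).2
  refine ⟨z₁ + Complex.I * z₂, ?_⟩
  rw [← realPart_add_I_smul_imaginaryPart y, mul_add, add_mul, h₁, mul_smul_comm, smul_mul_assoc,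
    h₂, smul_smul, add_smul]

end Maximal

theorem exists_projections {H : Type u} [NormedAddCommGroup H] [InnerProductSpace ℂ H]
    [CompleteSpace H] {M : VonNeumannAlgebra H} {x0 : H} (hx0 : ‖x0‖ = 1) {K : ℝ}
    (hK : ∀ A ∈ M, ‖A‖ ≤ K * ‖A x0‖) :
    ∃ (J : Type u) (_ : Fintype J) (p : J → (H →L[ℂ] H)), (∀ j, p j ∈ M) ∧
      (∀ j, IsSelfAdjoint (p j)) ∧ (∀ j, p j * p j = p j) ∧ ∑ j, p j = 1 ∧
      ∀ j, ∀ y ∈ M, ∃ z : ℂ, p j * y * p j = z • p j := by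
  obtain ⟨s, hs, hmax⟩ := exists_maximal_isOrthoFamily hx0 hK
  have h1 : ∀ j : s, ∃ c : ℝ, c ≠ 0 ∧ (j : H →L[ℂ] H) * j = (c : ℂ) • (j : H →L[ℂ] H) :=
    fun j => hs.exists_mul_self_eq_smul_of_maximal hmax j.2
  choose c hc0 hc using h1
  let p : s → (H →L[ℂ] H) := fun j => ((c j)⁻¹ : ℂ) • (j : H →L[ℂ] H)
  have hpM : ∀ j, p j ∈ M := fun j => smul_mem_vonNeumann _ (hs.1 j j.2).1
  have hpsa : ∀ j, IsSelfAdjoint (p j) := fun j => by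
    rw [isSelfAdjoint_iff]; simp [p, (hs.1 j j.2).2.1.star_eq]
  have hpj : ∀ j, p j * (j : H →L[ℂ] H) = j := fun j => by
    have : (c j : ℂ) ≠ 0 := by exact_mod_cast hc0 j
    simp only [p, smul_mul_assoc, hc]
    exact inv_smul_smul₀ this _
  have hpp : ∀ j, p j * p j = p j := fun j => by
    conv_lhs => rhs; simp only [p]
    rw [mul_smul_comm, hpj]
  refine ⟨s, inferInstance, p, hpM, hpsa, hpp, ?_, fun j y hy => ?_⟩
  · have : 1 - ∑ j, p j = 0 := by
      refine hs.eq_zero_of_maximal hmax (sub_mem (one_mem M) (sum_mem fun j _ => hpM j))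
        ((IsSelfAdjoint.one _).sub (isSelfAdjoint_sum _ fun j _ => hpsa j)) fun q hq => ?_
      rw [sub_mul, one_mul, Finset.sum_mul, Finset.sum_eq_single ⟨q, hq⟩ (fun j _ hj => ?_) (by simp),
        hpj, sub_self]
      rw [smul_mul_assoc, hs.2 j j.2 q hq fun h => hj (Subtype.ext h), smul_zero]
    exact (sub_eq_zero.1 this).symm
  · obtain ⟨z, hz⟩ := hs.exists_corner_of_maximal hmax j.2 hy
    refine ⟨(c j)⁻¹ * z, ?_⟩
    simp only [p, smul_mul_assoc, mul_smul_comm, hz, smul_smul]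
    congr 1
    push_cast
    ring

theorem exists_offDiagonal {M : VonNeumannAlgebra H} {p q : H →L[ℂ] H} (hp : p ∈ M) (hq : q ∈ M)
    (hpsa : IsSelfAdjoint p) (hqsa : IsSelfAdjoint q) (hpp : p * p = p) (hqq : q * q = q)
    (hpc : ∀ y ∈ M, ∃ z : ℂ, p * y * p = z • p) (hqc : ∀ y ∈ M, ∃ z : ℂ, q * y * q = z • q) :
    ∃ f ∈ M, ∀ y ∈ M, ∃ z : ℂ, p * y * q = z • f := by
  by_cases h : ∀ x ∈ M, p * x * q = 0
  · exact ⟨0, zero_mem _, fun y hy => ⟨0, by simp [h y hy]⟩⟩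
  push Not at h
  obtain ⟨x, hx, hX⟩ := h
  refine ⟨p * x * q, mul_mem (mul_mem hp hx) hq, fun y hy => ?_⟩
  obtain ⟨m, hm⟩ := hpc (x * q * star x) (mul_mem (mul_mem hx hq) (star_mem hx))
  obtain ⟨n, hn⟩ := hqc (star x * p * y) (mul_mem (mul_mem (star_mem hx) hp) hy)
  have h1 : (p * x * q) * star (p * x * q) = m • p := by
    rw [← hm]
    simp only [star_mul, hpsa.star_eq, hqsa.star_eq]
    calc _ = p * x * (q * q) * star x * p := by simp only [mul_assoc]
      _ = _ := by rw [hqq]; simp only [mul_assoc]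
  have h2 : star (p * x * q) * (p * y * q) = n • q := by
    rw [← hn]
    simp only [star_mul, hpsa.star_eq, hqsa.star_eq]
    calc _ = q * star x * (p * p) * y * q := by simp only [mul_assoc]
      _ = _ := by rw [hpp]; simp only [mul_assoc]
  have hm0 : m ≠ 0 := fun h0 => hX <| by
    rw [← CStarRing.mul_star_self_eq_zero_iff, h1, h0, zero_smul]
  have h3 : m • (p * y * q) = n • (p * x * q) := by
    calc m • (p * y * q) = (m • p) * (p * y * q) := by
          rw [smul_mul_assoc, ← mul_assoc, ← mul_assoc, hpp]
      _ = (p * x * q) * (n • q) := by rw [← h1, mul_assoc, h2]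
      _ = n • (p * x * q) := by rw [mul_smul_comm, mul_assoc, hqq]
  exact ⟨m⁻¹ * n, by rw [mul_smul, ← h3, inv_smul_smul₀ hm0]⟩

theorem exists_finite_spanning {M : VonNeumannAlgebra H} {x0 : H} (hx0 : ‖x0‖ = 1) {K : ℝ}
    (hK : ∀ A ∈ M, ‖A‖ ≤ K * ‖A x0‖) :
    ∃ (n : ℕ) (f : Fin n → (H →L[ℂ] H)), (∀ i, f i ∈ M) ∧
      ∀ A ∈ M, ∃ c : Fin n → ℂ, A = ∑ i, c i • f i := by
  obtain ⟨J, _, p, hpM, hpsa, hpp, hsum, hpc⟩ := exists_projections hx0 hK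
  have := fun k : J × J => exists_offDiagonal (hpM k.1) (hpM k.2) (hpsa k.1) (hpsa k.2)
    (hpp k.1) (hpp k.2) (hpc k.1) (hpc k.2)
  choose f hfM hf using this
  let e := Fintype.equivFin (J × J)
  refine ⟨_, f ∘ e.symm, fun i => hfM _, fun A hA => ?_⟩
  choose z hz using fun k => hf k A hA
  refine ⟨z ∘ e.symm, ?_⟩
  refine Eq.trans ?_ (e.symm.sum_comp fun k => z k • f k).symm
  simp_rw [← hz, Fintype.sum_prod_type, ← Finset.mul_sum, hsum, mul_one, ← Finset.sum_mul, hsum,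
    one_mul]

/-! ### The finite dimensional case -/

theorem finiteDimensional_of_spanning {M : VonNeumannAlgebra H} {x0 : H} (hcyc : Cyclic M x0)
    {n : ℕ} {f : Fin n → (H →L[ℂ] H)}
    (hf : ∀ A ∈ M, ∃ c : Fin n → ℂ, A = ∑ i, c i • f i) : FiniteDimensional ℂ H := by
  let V : Submodule ℂ H := Submodule.span ℂ (Set.range fun i => f i x0)
  have : FiniteDimensional ℂ V := FiniteDimensional.span_of_finite ℂ (Set.finite_range _)
  have hsub : {y : H | ∃ A ∈ M, A x0 = y} ⊆ V := by
    rintro _ ⟨A, hA, rfl⟩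
    obtain ⟨c, rfl⟩ := hf A hA
    rw [sum_apply]
    exact sum_mem fun i _ => V.smul_mem _ (Submodule.subset_span ⟨i, rfl⟩)
  have hV : V = ⊤ := by
    refine Submodule.eq_top_iff'.2 fun y => ?_
    exact closure_minimal hsub V.closed_of_finiteDimensional (hcyc y)
  exact Module.finite_def.2 (hV ▸ Submodule.fg_span (Set.finite_range _))

theorem Cyclic.exists_apply_eq [FiniteDimensional ℂ H] {M : VonNeumannAlgebra H} {x0 : H}
    (hcyc : Cyclic M x0) (y : H) : ∃ A ∈ M, A x0 = y := by
  obtain ⟨A, hA⟩ := (LinearMap.range (orbitMap M x0)).closed_of_finiteDimensional.closure_subset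
    (hcyc.denseRange y)
  exact ⟨A, A.2, hA⟩

theorem isTraceClass_of_finiteDimensional [FiniteDimensional ℂ H] (T : H →L[ℂ] H) :
    IsTraceClass T := by
  let e := stdOrthonormalBasis ℂ H
  let n := Module.finrank ℂ H
  let y : ℕ → H := fun k => if h : k < n then e ⟨k, h⟩ else 0
  have hy : ∀ k ∉ Finset.range n, y k = 0 := fun k hk => dif_neg (by simpa using hk)
  refine ⟨fun k => T (y k), y, summable_of_ne_finset_zero (s := Finset.range n) fun k hk => ?_,
    fun z => ?_⟩
  · simp [hy k hk]
  · rw [tsum_eq_sum (s := Finset.range n) fun k hk => by simp [hy k hk], Finset.sum_range]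
    conv_lhs => rw [← e.sum_repr' z]
    simp [y, n]

/-- The bilinear pairing as a bilinear map, for a finite dimensional space. -/
def pairingLM {ι : Type*} [Fintype ι] (b : HilbertBasis ι ℂ H) :
    (H →L[ℂ] H) →ₗ[ℂ] (H →L[ℂ] H) →ₗ[ℂ] ℂ :=
  LinearMap.mk₂ ℂ (pairing b)
    (fun A B T => by simp [pairing, tr, Finset.sum_add_distrib])
    (fun c A T => by simp [pairing, tr, Finset.mul_sum])
    (fun A S T => by simp [pairing, tr, Finset.sum_add_distrib])
    (fun c A T => by simp [pairing, tr, Finset.mul_sum])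

theorem sum_rankOne {ι : Type*} [Fintype ι] (b : HilbertBasis ι ℂ H) (A : H →L[ℂ] H) :
    ∑ i, rankOne (A (b i)) (b i) = A := by
  ext z
  conv_rhs => rw [← b.toOrthonormalBasis.sum_repr' z]
  simp [rankOne_apply, sum_apply]

theorem sum_inner_smul_rankOne {ι : Type*} [Fintype ι] (b : HilbertBasis ι ℂ H) (A : H →L[ℂ] H) :
    ∑ i, ∑ j, ⟪b i, A (b j)⟫ • rankOne (b i) (b j) = A := by
  rw [Finset.sum_comm]
  conv_rhs => rw [← sum_rankOne b A]
  refine Finset.sum_congr rfl fun j _ => ?_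
  ext z
  conv_rhs => rw [rankOne_apply, ← b.toOrthonormalBasis.sum_repr' (A (b j))]
  simp [rankOne_apply, sum_apply, Finset.smul_sum, smul_smul, mul_comm]

theorem exists_isNormalPair [FiniteDimensional ℂ H] {ι : Type*} [Fintype ι]
    (b : HilbertBasis ι ℂ H) (Φ : (H →L[ℂ] H) →ₗ[ℂ] (H →L[ℂ] H)) :
    ∃ Φst, IsNormalPair b Φ Φst := by
  refine ⟨∑ i, ∑ j, (pairingLM b (Φ (rankOne (b i) (b j)))).smulRight (rankOne (b j) (b i)),
    fun T _ => isTraceClass_of_finiteDimensional _, fun A T _ => ?_⟩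
  change pairingLM b (Φ A) T = pairingLM b A _
  conv_lhs => rw [← sum_inner_smul_rankOne b A]
  have h : ∀ i j, pairingLM b A (rankOne (b i) (b j)) = ⟪b j, A (b i)⟫ := fun i j =>
    pairing_rankOne b A _ _
  simp [LinearMap.sum_apply, h, mul_comm]

/-- The elementary operator `A ↦ Σₖ Pₖ A Qₖ`. -/
def elementary {ι : Type*} [Fintype ι] (P Q : ι → (H →L[ℂ] H)) :
    (H →L[ℂ] H) →ₗ[ℂ] (H →L[ℂ] H) :=
  ∑ k, LinearMap.mulLeftRight ℂ (P k, Q k)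

theorem elementary_apply {ι : Type*} [Fintype ι] (P Q : ι → (H →L[ℂ] H)) (A : H →L[ℂ] H) :
    elementary P Q A = ∑ k, P k * A * Q k := by
  simp [elementary, LinearMap.sum_apply]

theorem elementary_mem {ι : Type*} [Fintype ι] {M : VonNeumannAlgebra H} {P Q : ι → (H →L[ℂ] H)}
    (hP : ∀ k, P k ∈ M) (hQ : ∀ k, Q k ∈ M) {A : H →L[ℂ] H} (hA : A ∈ M) :
    elementary P Q A ∈ M := by
  rw [elementary_apply]
  exact sum_mem fun k _ => mul_mem (mul_mem (hP k) hA) (hQ k)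

theorem extendsTilde_elementary {ι : Type*} [Fintype ι] {M : VonNeumannAlgebra H}
    {P : ι → (H →L[ℂ] H)} (Q : ι → (H →L[ℂ] H)) (hP : ∀ k, P k ∈ M) :
    ExtendsTilde M (elementary P Q) (elementary P Q) := fun C hC B _ => by
  rw [elementary_apply, elementary_apply, Finset.mul_sum]
  refine Finset.sum_congr rfl fun k _ => ?_
  rw [← mul_assoc, commute_of_mem (hP k) hC]
  simp only [mul_assoc]

theorem exists_C_eq [FiniteDimensional ℂ H] {ι : Type*} [Fintype ι] (b : HilbertBasis ι ℂ H)
    {M : VonNeumannAlgebra H} {x0 : H} (hcyc : Cyclic M x0) (X : H →L[ℂ] H) :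
    ∃ φ Φ Φst : (H →L[ℂ] H) →ₗ[ℂ] (H →L[ℂ] H), (∀ B ∈ M, φ B ∈ M) ∧
      ExtendsTilde M φ Φ ∧ IsNormalPair b Φ Φst ∧ Φ (rankOne x0 x0) = X := by
  choose r hr hrx using hcyc.exists_apply_eq
  obtain ⟨Φst, hN⟩ := exists_isNormalPair b
    (elementary (fun k => r (X (b k))) fun k => star (r (b k)))
  refine ⟨_, _, Φst, fun B hB => elementary_mem (fun _ => hr _) (fun _ => star_mem (hr _)) hB,
    extendsTilde_elementary _ fun _ => hr _, hN, ?_⟩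
  rw [elementary_apply]
  conv_rhs => rw [← sum_rankOne b X]
  refine Finset.sum_congr rfl fun k _ => ?_
  rw [mul_rankOne, hrx]
  ext z
  simp [rankOne_apply, star_eq_adjoint, adjoint_inner_right, hrx]

theorem exists_D_eq [FiniteDimensional ℂ H] {ι : Type*} [Fintype ι] (b : HilbertBasis ι ℂ H)
    {M : VonNeumannAlgebra H} {x0 : H} (hcyc : Cyclic M x0) (T : H →L[ℂ] H) :
    ∃ φ Φ Φst : (H →L[ℂ] H) →ₗ[ℂ] (H →L[ℂ] H), (∀ B ∈ M, φ B ∈ M) ∧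
      ExtendsTilde M φ Φ ∧ IsNormalPair b Φ Φst ∧ Φst (rankOne x0 x0) = T := by
  choose r hr hrx using hcyc.exists_apply_eq
  obtain ⟨Φst, hN⟩ := exists_isNormalPair b
    (elementary (fun k => star (r (b k))) fun k => r (T (b k)))
  refine ⟨_, _, Φst, fun B hB => elementary_mem (fun _ => star_mem (hr _)) (fun _ => hr _) hB,
    extendsTilde_elementary _ fun _ => star_mem (hr _), hN, ?_⟩
  have key : ∀ A, pairing b A (Φst (rankOne x0 x0)) = pairing b A T := fun A => by
    rw [← hN.2 _ _ (isTraceClass_rankOne _ _), pairing_rankOne, elementary_apply]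
    simp [pairing, tr, sum_apply, star_eq_adjoint, adjoint_inner_right, hrx]
  refine ContinuousLinearMap.ext fun u => ext_inner_left ℂ fun v => ?_
  rw [← pairing_rankOne_left b, ← pairing_rankOne_left b, key]

end Helpers

/-- Theorem 3.3.  The following are equivalent:
(i) `φ ↦ C_φ : CB^σ_ε(M) → B(H)` is surjective;
(ii) `φ ↦ D_φ : CB^σ_ε(M) → T(H)` is surjective;
(iii) `{A x0 : A ∈ M} = H`; (iv) `M` is finite dimensional. -/
theorem statement5
    {H : Type*} [NormedAddCommGroup H] [InnerProductSpace ℂ H] [CompleteSpace H]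
    [TopologicalSpace.SeparableSpace H]
    {ι : Type*} (b : HilbertBasis ι ℂ H)
    (M : VonNeumannAlgebra H) (hfactor : IsFactor M)
    (x0 : H) (hx0 : ‖x0‖ = 1) (hcyc : Cyclic M x0) (hsep : Separating M x0) :
    List.TFAE [
      ∀ X : H →L[ℂ] H, ∃ φ Φ Φst : (H →L[ℂ] H) →ₗ[ℂ] (H →L[ℂ] H), (∀ B ∈ M, φ B ∈ M) ∧
        ExtendsTilde M φ Φ ∧ IsNormalPair b Φ Φst ∧ Φ (rankOne x0 x0) = X,
      ∀ T : H →L[ℂ] H, IsTraceClass T →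
        ∃ φ Φ Φst : (H →L[ℂ] H) →ₗ[ℂ] (H →L[ℂ] H), (∀ B ∈ M, φ B ∈ M) ∧
          ExtendsTilde M φ Φ ∧ IsNormalPair b Φ Φst ∧ Φst (rankOne x0 x0) = T,
      ∀ y : H, ∃ A ∈ M, A x0 = y,
      ∃ (n : ℕ) (f : Fin n → (H →L[ℂ] H)), (∀ i, f i ∈ M) ∧
        ∀ A ∈ M, ∃ c : Fin n → ℂ, A = ∑ i, c i • f i] := by
  tfae_have 1 → 3 := fun h z => by
    obtain ⟨φ, Φ, Φst, -, hE, hN, h1⟩ := h 1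
    exact surjective_orbit_of_surjective_C b hfactor hsep ⟨φ, Φ, Φst, hE, hN, h1⟩ z
  tfae_have 2 → 3 := fun h z => by
    obtain ⟨φ, Φ, Φst, -, hE, hN, hz⟩ := h _ (isTraceClass_rankOne x0 z)
    exact exists_apply_eq_of_D b hfactor hx0 hsep ⟨φ, Φ, Φst, hE, hN, hz⟩
  tfae_have 3 → 4 := fun h => by
    obtain ⟨K, hK⟩ := exists_norm_le_of_surjective hsep h
    exact exists_finite_spanning hx0 hK
  tfae_have 4 → 1 := fun ⟨n, f, _, hf⟩ X => by
    have := finiteDimensional_of_spanning hcyc hf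
    have := b.orthonormal.linearIndependent.finite_of_isNoetherian
    have := Fintype.ofFinite ι
    exact exists_C_eq b hcyc X
  tfae_have 4 → 2 := fun ⟨n, f, _, hf⟩ T _ => by
    have := finiteDimensional_of_spanning hcyc hf
    have := b.orthonormal.linearIndependent.finite_of_isNoetherian
    have := Fintype.ofFinite ι
    exact exists_D_eq b hcyc T
  tfae_finish

end ChoiInf
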